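/- arXiv:1806.06851 — 2 statements merged into one kernel-verified Lean document; each statement's English description precedes it below -/
import Mathlib

section
/- Every simple connected graph G with |G| ≥ 4 has an orthogonal representation in ℝ^{Δ(G)+1} = ℝ^{|G|−δ(G)} (where Δ and δ are computed so that Δ(G) + 1 ≤ |G| − δ(G) when the bound is stated via the complement); consequently msr(G) ≤ |G| − δ(G), i.e., G satisfies the Delta Conjecture. -/
open SimpleGraph
open scoped RealInnerProductSpace

/-- An orthogonal representation of a simple graph `G` in `ℝ^d`: an assignment of a vector
to each vertex so that, for distinct vertices, the inner product is nonzero iff they are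
adjacent. -/
def HasOrthoRep {V : Type*} (G : SimpleGraph V) (d : ℕ) : Prop :=
  ∃ f : V → EuclideanSpace ℝ (Fin d),
    ∀ i j : V, i ≠ j → (⟪f i, f j⟫ ≠ 0 ↔ G.Adj i j)

/-- The minimum semidefinite rank of `G`: the smallest `d` such that `G` has an
orthogonal representation in `ℝ^d`. -/
noncomputable def msr {V : Type*} (G : SimpleGraph V) : ℕ :=
  sInf {d : ℕ | HasOrthoRep G d}

section Rejection

variable {ι R S : Type*} [Fintype ι] [DecidableEq ι] [CommRing R] [CommRing S] {d : ℕ}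

/-- The component of `y` orthogonal to the rows of `X`, multiplied by the Gram determinant of the
rows so that it is polynomial in the entries. -/
def rejection (X : Matrix ι (Fin d) R) (y : Fin d → R) : Fin d → R :=
  (X * X.transpose).det • y -
    X.transpose.mulVec ((X * X.transpose).adjugate.mulVec (X.mulVec y))

lemma mulVec_rejection (X : Matrix ι (Fin d) R) (y : Fin d → R) :
    X.mulVec (rejection X y) = 0 := by
  rw [rejection, Matrix.mulVec_sub, Matrix.mulVec_smul, Matrix.mulVec_mulVec,
    Matrix.mulVec_mulVec, Matrix.mul_adjugate, Matrix.smul_mulVec, Matrix.one_mulVec, sub_self]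

lemma rejection_eq_smul {X : Matrix ι (Fin d) R} {y : Fin d → R} (h : X.mulVec y = 0) :
    rejection X y = (X * X.transpose).det • y := by
  rw [rejection, h, Matrix.mulVec_zero, Matrix.mulVec_zero, sub_zero]

lemma RingHom.comp_mulVec {m n R S : Type*} [Fintype n] [CommRing R] [CommRing S] (φ : R →+* S)
    (A : Matrix m n R) (x : n → R) : φ ∘ A.mulVec x = (A.map φ).mulVec (φ ∘ x) :=
  funext (RingHom.map_mulVec φ A x)

lemma map_rejection (φ : R →+* S) (X : Matrix ι (Fin d) R) (y : Fin d → R) :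
    φ ∘ rejection X y = rejection (X.map φ) (φ ∘ y) := by
  have hG : (X * X.transpose).map φ = X.map φ * (X.map φ).transpose := by
    rw [Matrix.map_mul, Matrix.transpose_map]
  have hadj : (X * X.transpose).adjugate.map φ = (X.map φ * (X.map φ).transpose).adjugate := by
    rw [← hG]
    exact RingHom.map_adjugate φ _
  have hdet : φ (X * X.transpose).det = (X.map φ * (X.map φ).transpose).det := by
    rw [← hG]
    exact RingHom.map_det φ _
  have hsub : φ ∘ rejection X y = φ (X * X.transpose).det • (φ ∘ y) -
      φ ∘ X.transpose.mulVec ((X * X.transpose).adjugate.mulVec (X.mulVec y)) := by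
    funext i
    simp [rejection]
  rw [hsub, RingHom.comp_mulVec, RingHom.comp_mulVec, RingHom.comp_mulVec, hadj, hdet,
    Matrix.transpose_map, rejection]

end Rejection

/-- The Gram determinant of the rows of a real matrix detects their linear independence. -/
lemma det_mul_transpose_ne_zero_iff {ι : Type*} [Fintype ι] [DecidableEq ι] {d : ℕ}
    (X : Matrix ι (Fin d) ℝ) :
    (X * X.transpose).det ≠ 0 ↔ LinearIndependent ℝ X.row := by
  have hX : X * X.transpose = Matrix.gram ℝ fun i => WithLp.toLp 2 (X i) := by
    ext i j
    simp [Matrix.mul_apply, Matrix.gram_apply, PiLp.inner_apply, mul_comm]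
  rw [hX, Matrix.det_gram_ne_zero_iff_linearIndependent]
  exact LinearMap.linearIndependent_iff (WithLp.linearEquiv 2 ℝ (Fin d → ℝ)).symm.toLinearMap
    (LinearEquiv.ker _)

lemma exists_mulVec_eq {ι : Type*} [Fintype ι] {d : ℕ} {X : Matrix ι (Fin d) ℝ}
    (h : LinearIndependent ℝ X.row) (w : ι → ℝ) : ∃ p, X.mulVec p = w := by
  classical
  have hX := isUnit_iff_ne_zero.2 ((det_mul_transpose_ne_zero_iff X).2 h)
  refine ⟨X.transpose.mulVec ((X * X.transpose)⁻¹.mulVec w), ?_⟩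
  rw [Matrix.mulVec_mulVec, Matrix.mulVec_mulVec, Matrix.mul_nonsing_inv _ hX, Matrix.one_mulVec]

lemma LinearIndepOn.of_eq_smul {V E : Type*} [AddCommGroup E] [Module ℝ E] {g h : V → E}
    {S : Set V} (hg : LinearIndepOn ℝ g S) (H : ∀ u ∈ S, ∃ c : ℝ, c ≠ 0 ∧ h u = c • g u) :
    LinearIndepOn ℝ h S := by
  choose! c hc hcg using H
  have := LinearIndependent.units_smul hg fun u => Units.mk0 (c u) (hc u u.2)
  have e : (fun u : S => h u) = (fun u : S => Units.mk0 (c u) (hc u u.2)) • fun u : S => g u :=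
    funext fun u => hcg u u.2
  rw [LinearIndepOn, e]
  exact this

lemma exists_eval_ne_zero {σ κ : Type*} [Fintype κ] (p : κ → MvPolynomial σ ℝ)
    (h : ∀ k, ∃ x : σ → ℝ, MvPolynomial.eval x (p k) ≠ 0) :
    ∃ x : σ → ℝ, ∀ k, MvPolynomial.eval x (p k) ≠ 0 := by
  have hp : ∏ k, p k ≠ 0 := by
    refine Finset.prod_ne_zero_iff.2 fun k _ h0 => ?_
    obtain ⟨x, hx⟩ := h k
    exact hx (by rw [h0, map_zero])
  by_contra! hc
  refine hp (MvPolynomial.funext fun x => ?_)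
  obtain ⟨k, hk⟩ := hc x
  rw [map_prod, map_zero]
  exact Finset.prod_eq_zero (Finset.mem_univ k) hk

section Thin

variable {V : Type*} {ℓ : V → ℕ} {d : ℕ}

/-- A vertex set is `d`-thin if at most `d - j` of its vertices have level at least `j`, for all
`j ≤ d`. -/
def IsThin (ℓ : V → ℕ) (d : ℕ) (S : Finset V) : Prop :=
  ∀ j ≤ d, (S.filter fun v => j ≤ ℓ v).card + j ≤ d

lemma IsThin.lt {S : Finset V} (h : IsThin ℓ d S) {v : V} (hv : v ∈ S) : ℓ v < d := by
  by_contra! hc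
  have : 0 < (S.filter fun v => d ≤ ℓ v).card :=
    Finset.card_pos.2 ⟨v, Finset.mem_filter.2 ⟨hv, hc⟩⟩
  have := h d le_rfl
  omega

open Classical in
lemma IsThin.erase {S : Finset V} (h : IsThin ℓ (d + 1) S) {v : V} (hv : v ∈ S)
    (hmax : ∀ u ∈ S, ℓ u ≤ ℓ v) : IsThin ℓ d (S.erase v) := by
  intro j hj
  by_cases hjv : j ≤ ℓ v
  · have := Finset.card_erase_add_one (Finset.mem_filter.2 ⟨hv, hjv⟩ :
      v ∈ S.filter fun u => j ≤ ℓ u)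
    have := h j (by omega)
    rw [Finset.filter_erase]
    omega
  · rw [Finset.filter_eq_empty_iff.2 fun u hu => ?_, Finset.card_empty]
    · omega
    · have := hmax u (Finset.mem_of_mem_erase hu)
      omega

open Classical in
lemma linearIndepOn_insert_cons {f : V → Fin d → ℝ} {T : Finset V} {v : V} (hv : v ∉ T)
    (hf : LinearIndepOn ℝ f T) :
    LinearIndepOn ℝ (fun u => if u = v then (Fin.cons 1 0 : Fin (d + 1) → ℝ) else
      Fin.cons 0 (f u)) (insert v T : Finset V) := by
  rw [linearIndepOn_finset_iff] at hf ⊢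
  intro c hc
  rw [Finset.sum_insert hv, if_pos rfl, Finset.sum_congr rfl fun u hu => by
    rw [if_neg (ne_of_mem_of_not_mem hu hv)]] at hc
  have h0 : c v = 0 := by
    have := congrFun hc 0
    simpa [Finset.sum_apply] using this
  intro u hu
  rcases Finset.mem_insert.1 hu with rfl | hu
  · exact h0
  · refine hf c ?_ u hu
    funext i
    have := congrFun hc i.succ
    simpa [Finset.sum_apply, h0] using this

end Thin

section Leveling

variable {V : Type*} [Fintype V]

open Classical in
/-- The neighbors of `v` in `H` whose level is below `k`. -/
noncomputable def lowerNeighbors (H : SimpleGraph V) (ℓ : V → ℕ) (v : V) (k : ℕ) : Finset V :=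
  {u | H.Adj v u ∧ ℓ u < k}

lemma mem_lowerNeighbors {H : SimpleGraph V} {ℓ : V → ℕ} {u v : V} {k : ℕ} :
    u ∈ lowerNeighbors H ℓ v k ↔ H.Adj v u ∧ ℓ u < k := by
  simp [lowerNeighbors]

/-- The levels produced by a vertex ordering in which every vertex has as few earlier neighbors as
possible: the level of a vertex is its number of earlier neighbors. -/
structure IsGreedyLeveling (H : SimpleGraph V) (ℓ : V → ℕ) : Prop where
  ne_of_adj : ∀ {u v}, H.Adj u v → ℓ u ≠ ℓ v
  card_eq : ∀ v, (lowerNeighbors H ℓ v (ℓ v)).card = ℓ v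
  le_card : ∀ v, ∀ j ≤ ℓ v, j ≤ (lowerNeighbors H ℓ v j).card

open Classical in
lemma exists_greedyLeveling_below (H : SimpleGraph V) (k : ℕ) :
    ∃ ℓ : V → ℕ, (∀ v, ℓ v ≤ k) ∧ (∀ u v, H.Adj u v → ℓ u = ℓ v → ℓ v = k) ∧
      (∀ v, ℓ v < k → (lowerNeighbors H ℓ v (ℓ v)).card = ℓ v) ∧
      ∀ v, ∀ j ≤ ℓ v, j ≤ (lowerNeighbors H ℓ v j).card := by
  induction k with
  | zero => exact ⟨fun _ => 0, by simp, by simp, by simp, by simp⟩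
  | succ k ih =>
    obtain ⟨ℓ, hle, hadj, hcard, hlow⟩ := ih
    obtain ⟨I, hI⟩ := (Set.toFinite {I : Finset V | (∀ v ∈ I, ℓ v = k ∧
      (lowerNeighbors H ℓ v k).card = k) ∧ ∀ u ∈ I, ∀ v ∈ I, ¬ H.Adj u v}).exists_maximal
      ⟨∅, by simp⟩
    set ℓ' : V → ℕ := fun v => if ℓ v = k ∧ v ∉ I then k + 1 else ℓ v with hℓ'
    have hlt : ∀ u, ∀ j ≤ k, (ℓ' u < j ↔ ℓ u < j) := by
      intro u j hj
      simp only [hℓ']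
      split_ifs <;> omega
    have hN : ∀ v, ∀ j ≤ k, lowerNeighbors H ℓ' v j = lowerNeighbors H ℓ v j := by
      intro v j hj
      ext u
      simp [mem_lowerNeighbors, hlt u j hj]
    have hIk : ∀ v, ℓ' v = k ↔ v ∈ I := by
      intro v
      have := hle v
      have h1 := fun h => (hI.prop.1 v h).1
      simp only [hℓ']
      split_ifs with h
      · simp [h.2]
      · tauto
    have hold : ∀ v, ℓ' v ≤ k → ℓ' v = ℓ v := by
      intro v hv
      simp only [hℓ'] at hv ⊢
      split_ifs at hv ⊢
      · omega
      · rfl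
    have hle' : ∀ v, ℓ' v ≤ k + 1 := by
      intro v
      have := hle v
      simp only [hℓ']
      split_ifs <;> omega
    refine ⟨ℓ', hle', ?_, ?_, ?_⟩
    · intro u v huv h
      by_contra hne
      have hvk : ℓ' v ≤ k := by have := hle' v; omega
      have hv := hold v hvk
      have hu := hold u (h ▸ hvk)
      have := hadj u v huv (by omega)
      exact hI.prop.2 u ((hIk u).1 (by omega)) v ((hIk v).1 (by omega)) huv
    · intro v hv
      rw [hN v _ (by omega)]
      rcases (show ℓ' v < k ∨ ℓ' v = k by omega) with h | h
      · have e := hold v h.le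
        rw [e] at h ⊢
        exact hcard v h
      · rw [h]
        exact (hI.prop.1 v ((hIk v).1 h)).2
    · intro v j hj
      rcases (show j ≤ k ∨ j = k + 1 by have := hle' v; omega) with h | rfl
      · rw [hN v j h]
        refine hlow v j ?_
        by_contra hc
        have := (hlt v j h).2 (by omega)
        omega
      · have hvk : ℓ v = k ∧ v ∉ I := by
          by_contra hc
          have := hle v
          simp only [hℓ', if_neg hc] at hj
          omega
        have hsub : lowerNeighbors H ℓ v k ⊆ lowerNeighbors H ℓ' v (k + 1) := by
          intro u hu
          rw [mem_lowerNeighbors] at hu ⊢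
          have := (hlt u k le_rfl).2 hu.2
          exact ⟨hu.1, by omega⟩
        have hk := hlow v k hvk.1.ge
        by_cases heq : (lowerNeighbors H ℓ v k).card = k
        · obtain ⟨w, hw, hvw⟩ : ∃ w ∈ I, H.Adj v w := by
            by_contra! hc
            refine hvk.2 (hI.le_of_ge (y := insert v I) ⟨?_, ?_⟩ (Finset.subset_insert v I)
              (Finset.mem_insert_self v I))
            · intro u hu
              rcases Finset.mem_insert.1 hu with rfl | hu
              · exact ⟨hvk.1, heq⟩
              · exact hI.prop.1 u hu
            · intro a ha b hb
              rcases Finset.mem_insert.1 ha with ea | ha <;>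
                rcases Finset.mem_insert.1 hb with eb | hb
              · rw [ea, eb]
                exact H.irrefl
              · rw [ea]
                exact hc b hb
              · rw [eb]
                exact fun h => hc a ha h.symm
              · exact hI.prop.2 a ha b hb
          have hw' : ℓ' w = k := (hIk w).2 hw
          have : (lowerNeighbors H ℓ v k).card < (lowerNeighbors H ℓ' v (k + 1)).card := by
            refine Finset.card_lt_card (Finset.ssubset_iff.2 ⟨w, ?_, ?_⟩)
            · rw [mem_lowerNeighbors, ← hlt w k le_rfl]
              omega
            · refine Finset.insert_subset ?_ hsub
              rw [mem_lowerNeighbors]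
              exact ⟨hvw, by omega⟩
          omega
        · have := Finset.card_le_card hsub
          omega

lemma exists_isGreedyLeveling (H : SimpleGraph V) : ∃ ℓ : V → ℕ, IsGreedyLeveling H ℓ := by
  obtain ⟨ℓ, -, hadj, hcard, hlow⟩ := exists_greedyLeveling_below H (Fintype.card V + 1)
  have hlt : ∀ v, ℓ v < Fintype.card V + 1 := fun v =>
    Nat.lt_succ_of_le ((hlow v _ le_rfl).trans (Finset.card_le_univ _))
  exact ⟨ℓ, fun {u v} h he => (hlt v).ne (hadj u v h he), fun v => hcard v (hlt v), hlow⟩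

variable {H : SimpleGraph V} {ℓ : V → ℕ} {d : ℕ}

open Classical in
/-- The vectors obtained from `y` by making each vertex orthogonal to its neighbors of lower
level. -/
noncomputable def orthoSeq {R : Type*} [CommRing R] (H : SimpleGraph V) (ℓ : V → ℕ)
    (y : V → Fin d → R) (v : V) : Fin d → R :=
  rejection (Matrix.of fun u : lowerNeighbors H ℓ v (ℓ v) => orthoSeq H ℓ y u.1) (y v)
termination_by ℓ v
decreasing_by exact (mem_lowerNeighbors.1 u.2).2

open Classical in
lemma map_orthoSeq {R S : Type*} [CommRing R] [CommRing S] (φ : R →+* S)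
    (y : V → Fin d → R) (v : V) :
    φ ∘ orthoSeq H ℓ y v = orthoSeq H ℓ (fun u => φ ∘ y u) v := by
  induction h : ℓ v using Nat.strong_induction_on generalizing v with
  | _ n ih =>
    subst h
    rw [orthoSeq, orthoSeq, map_rejection]
    congr 1
    ext u i
    exact congrFun (ih _ (mem_lowerNeighbors.1 u.2).2 u.1 rfl) i

lemma orthoSeq_dotProduct {R : Type*} [CommRing R] (y : V → Fin d → R) {u v : V}
    (h : H.Adj v u) (hlt : ℓ u < ℓ v) : orthoSeq H ℓ y u ⬝ᵥ orthoSeq H ℓ y v = 0 := by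
  classical
  have key := congrFun (mulVec_rejection
    (Matrix.of fun u : lowerNeighbors H ℓ v (ℓ v) => orthoSeq H ℓ y u.1) (y v))
    ⟨u, mem_lowerNeighbors.2 ⟨h, hlt⟩⟩
  rw [orthoSeq.eq_def H ℓ y v]
  exact key

/-- A configuration that is already orthogonal along `H` on the levels up to `k`, with independent
lower neighborhoods, is only rescaled by `orthoSeq` on these levels. -/
lemma orthoSeq_eq_smul {g : V → Fin d → ℝ} {k : ℕ}
    (hind : ∀ v, ℓ v ≤ k → LinearIndepOn ℝ g (lowerNeighbors H ℓ v (ℓ v)))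
    (horth : ∀ u v, ℓ v ≤ k → H.Adj v u → ℓ u < ℓ v → g u ⬝ᵥ g v = 0) (v : V) (hv : ℓ v ≤ k) :
    ∃ c : ℝ, c ≠ 0 ∧ orthoSeq H ℓ g v = c • g v := by
  classical
  induction h : ℓ v using Nat.strong_induction_on generalizing v with
  | _ n ih =>
    subst h
    have ih' : ∀ u : lowerNeighbors H ℓ v (ℓ v), ∃ c : ℝ, c ≠ 0 ∧
        orthoSeq H ℓ g u.1 = c • g u.1 := fun u =>
      have hu := (mem_lowerNeighbors.1 u.2).2
      ih _ hu u.1 (hu.le.trans hv) rfl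
    choose c hc hcg using ih'
    set X : Matrix (lowerNeighbors H ℓ v (ℓ v)) (Fin d) ℝ :=
      Matrix.of fun u => orthoSeq H ℓ g u.1 with hX
    have hXi : LinearIndependent ℝ X.row :=
      LinearIndepOn.of_eq_smul (hind v hv) fun u hu => ⟨c ⟨u, hu⟩, hc _, hcg ⟨u, hu⟩⟩
    refine ⟨(X * X.transpose).det, (det_mul_transpose_ne_zero_iff X).2 hXi, ?_⟩
    have h0 : X.mulVec (g v) = 0 := by
      funext u
      have hu := mem_lowerNeighbors.1 u.2
      change orthoSeq H ℓ g u.1 ⬝ᵥ g v = 0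
      rw [hcg, smul_dotProduct, horth u.1 v hv hu.1 hu.2, smul_zero]
    rw [orthoSeq, ← rejection_eq_smul h0]

lemma eval_orthoSeq_generic (x : V × Fin d → ℝ) (v : V) :
    MvPolynomial.eval x ∘ orthoSeq H ℓ (fun u i => (MvPolynomial.X (u, i) :
      MvPolynomial (V × Fin d) ℝ)) v = orthoSeq H ℓ (fun u i => x (u, i)) v := by
  rw [map_orthoSeq]
  congr 1
  funext u i
  simp

lemma exists_forall_linearIndepOn_orthoSeq {κ : Type*} [Finite κ] (T : κ → Finset V)
    (h : ∀ k, ∃ y : V → Fin d → ℝ, LinearIndepOn ℝ (orthoSeq H ℓ y) (T k)) :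
    ∃ y : V → Fin d → ℝ, ∀ k, LinearIndepOn ℝ (orthoSeq H ℓ y) (T k) := by
  classical
  have := Fintype.ofFinite κ
  let M (k : κ) : Matrix (T k) (Fin d) (MvPolynomial (V × Fin d) ℝ) :=
    Matrix.of fun u => orthoSeq H ℓ (fun u i => MvPolynomial.X (u, i)) u.1
  have hM (x : V × Fin d → ℝ) (k : κ) : MvPolynomial.eval x (M k * (M k).transpose).det ≠ 0 ↔
      LinearIndepOn ℝ (orthoSeq H ℓ fun u i => x (u, i)) (T k) := by
    have e : (M k).map (MvPolynomial.eval x) =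
        Matrix.of fun u : T k => orthoSeq H ℓ (fun u i => x (u, i)) u.1 := by
      ext u i
      exact congrFun (eval_orthoSeq_generic x u.1) i
    rw [RingHom.map_det, RingHom.mapMatrix_apply, Matrix.map_mul, Matrix.transpose_map, e,
      det_mul_transpose_ne_zero_iff]
    rfl
  obtain ⟨x, hx⟩ := exists_eval_ne_zero (fun k => (M k * (M k).transpose).det) fun k => by
    obtain ⟨y, hy⟩ := h k
    exact ⟨fun a => y a.1 a.2, (hM _ k).2 hy⟩
  exact ⟨fun u i => x (u, i), fun k => (hM x k).1 (hx k)⟩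

lemma exists_forall_orthoSeq_dotProduct_ne_zero {κ : Type*} [Finite κ] (a b : κ → V)
    (h : ∀ k, ∃ y : V → Fin d → ℝ, orthoSeq H ℓ y (a k) ⬝ᵥ orthoSeq H ℓ y (b k) ≠ 0) :
    ∃ y : V → Fin d → ℝ, ∀ k, orthoSeq H ℓ y (a k) ⬝ᵥ orthoSeq H ℓ y (b k) ≠ 0 := by
  have := Fintype.ofFinite κ
  let q : V → Fin d → MvPolynomial (V × Fin d) ℝ :=
    orthoSeq H ℓ fun u i => MvPolynomial.X (u, i)
  have hq (x : V × Fin d → ℝ) (k : κ) : MvPolynomial.eval x (q (a k) ⬝ᵥ q (b k)) =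
      orthoSeq H ℓ (fun u i => x (u, i)) (a k) ⬝ᵥ orthoSeq H ℓ (fun u i => x (u, i)) (b k) := by
    rw [RingHom.map_dotProduct, eval_orthoSeq_generic, eval_orthoSeq_generic]
  obtain ⟨x, hx⟩ := exists_eval_ne_zero (fun k => q (a k) ⬝ᵥ q (b k)) fun k => by
    obtain ⟨y, hy⟩ := h k
    exact ⟨fun a => y a.1 a.2, by rw [hq]; exact hy⟩
  exact ⟨fun u i => x (u, i), fun k => by rw [← hq]; exact hx k⟩

open Classical in
lemma IsGreedyLeveling.card_filter_lowerNeighbors (hℓ : IsGreedyLeveling H ℓ) (v : V) {j : ℕ}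
    (hj : j ≤ ℓ v) :
    ((lowerNeighbors H ℓ v (ℓ v)).filter fun u => j ≤ ℓ u).card + j ≤ ℓ v := by
  have h1 := Finset.card_filter_add_card_filter_not (s := lowerNeighbors H ℓ v (ℓ v))
    fun u => j ≤ ℓ u
  have h2 : lowerNeighbors H ℓ v j ⊆
      (lowerNeighbors H ℓ v (ℓ v)).filter fun u => ¬ j ≤ ℓ u := by
    intro u hu
    rw [mem_lowerNeighbors] at hu
    rw [Finset.mem_filter, mem_lowerNeighbors]
    exact ⟨⟨hu.1, by omega⟩, by omega⟩
  have h3 := Finset.card_le_card h2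
  have h4 := hℓ.le_card v j hj
  have h5 := hℓ.card_eq v
  omega

lemma IsGreedyLeveling.isThin_lowerNeighbors (hℓ : IsGreedyLeveling H ℓ) {v : V} (hv : ℓ v ≤ d) :
    IsThin ℓ d (lowerNeighbors H ℓ v (ℓ v)) := by
  intro j hj
  by_cases hjv : j ≤ ℓ v
  · exact (hℓ.card_filter_lowerNeighbors v hjv).trans hv
  · rw [Finset.filter_eq_empty_iff.2 fun u hu => ?_, Finset.card_empty]
    · omega
    · have := (mem_lowerNeighbors.1 hu).2
      omega

open Classical in
lemma IsGreedyLeveling.isThin_insert (hℓ : IsGreedyLeveling H ℓ) {v w : V} (hv : ℓ v < d)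
    (hw : ℓ w ≤ ℓ v) : IsThin ℓ d (insert w (lowerNeighbors H ℓ v (ℓ v))) := by
  intro j hj
  by_cases hjv : j ≤ ℓ v
  · have h1 := hℓ.card_filter_lowerNeighbors v hjv
    have h2 : ((insert w (lowerNeighbors H ℓ v (ℓ v))).filter fun u => j ≤ ℓ u).card ≤
        ((lowerNeighbors H ℓ v (ℓ v)).filter fun u => j ≤ ℓ u).card + 1 := by
      rw [Finset.filter_insert]
      split_ifs
      · exact Finset.card_insert_le _ _
      · omega
    omega
  · rw [Finset.filter_eq_empty_iff.2 fun u hu => ?_, Finset.card_empty]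
    · omega
    · rcases Finset.mem_insert.1 hu with rfl | hu
      · omega
      · have := (mem_lowerNeighbors.1 hu).2
        omega

lemma IsGreedyLeveling.exists_linearIndepOn (hℓ : IsGreedyLeveling H ℓ) (d : ℕ) :
    ∃ y : V → Fin d → ℝ, ∀ S, IsThin ℓ d S → LinearIndepOn ℝ (orthoSeq H ℓ y) S := by
  classical
  induction d with
  | zero =>
    refine ⟨0, fun S hS => ?_⟩
    rw [Finset.eq_empty_of_forall_notMem fun v hv => (Nat.not_lt_zero _ (hS.lt hv)),
      Finset.coe_empty]
    exact linearIndepOn_empty _ _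
  | succ d ih =>
    obtain ⟨y, hy⟩ := ih
    suffices h : ∀ S : {S // IsThin ℓ (d + 1) S}, ∃ y : V → Fin (d + 1) → ℝ,
        LinearIndepOn ℝ (orthoSeq H ℓ y) S.1 by
      obtain ⟨y, hy⟩ := exists_forall_linearIndepOn_orthoSeq _ h
      exact ⟨y, fun S hS => hy ⟨S, hS⟩⟩
    rintro ⟨S, hS⟩
    rcases S.eq_empty_or_nonempty with rfl | hne
    · refine ⟨0, ?_⟩
      rw [Finset.coe_empty]
      exact linearIndepOn_empty _ _
    obtain ⟨v, hv, hmax⟩ := S.exists_max_image ℓ hne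
    have hvd : ℓ v ≤ d := Nat.lt_succ_iff.1 (hS.lt hv)
    let g : V → Fin (d + 1) → ℝ := fun u =>
      if u = v then Fin.cons 1 0 else Fin.cons 0 (orthoSeq H ℓ y u)
    have hg (T : Finset V) (hvT : v ∉ T) (hT : IsThin ℓ d T) :
        LinearIndepOn ℝ g (insert v T : Finset V) := linearIndepOn_insert_cons hvT (hy T hT)
    refine ⟨g, LinearIndepOn.of_eq_smul (g := g) ?_ fun u hu =>
      orthoSeq_eq_smul (k := ℓ v) ?_ ?_ u (hmax u hu)⟩
    · change LinearIndepOn ℝ g S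
      rw [← Finset.insert_erase hv]
      exact hg _ (Finset.notMem_erase v S) (hS.erase hv hmax)
    · intro u hu
      refine (hg _ (fun h => ?_) (hℓ.isThin_lowerNeighbors (hu.trans hvd))).mono
        (Finset.coe_subset.2 (Finset.subset_insert v _))
      have := (mem_lowerNeighbors.1 h).2
      omega
    · intro u w hw huw hlt
      have huv : u ≠ v := by
        rintro rfl
        omega
      have h0 := orthoSeq_dotProduct y huw hlt
      simp only [g, if_neg huv]
      split_ifs
      · simp [dotProduct, Fin.sum_univ_succ]
      · simpa [dotProduct, Fin.sum_univ_succ] using h0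

lemma IsGreedyLeveling.exists_orthoSeq_dotProduct_ne_zero (hℓ : IsGreedyLeveling H ℓ) {v w : V}
    (hv : ℓ v < d) (hle : ℓ w ≤ ℓ v) (hne : w ≠ v) (hadj : ¬ H.Adj v w) :
    ∃ y : V → Fin d → ℝ, orthoSeq H ℓ y w ⬝ᵥ orthoSeq H ℓ y v ≠ 0 := by
  classical
  obtain ⟨y, hy⟩ := hℓ.exists_linearIndepOn d
  let T := insert w (lowerNeighbors H ℓ v (ℓ v))
  obtain ⟨p, hp⟩ := exists_mulVec_eq (X := Matrix.of fun u : T => orthoSeq H ℓ y u.1)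
    (hy T (hℓ.isThin_insert hv hle)) fun u => if u.1 = w then 1 else 0
  have hp' (u : V) (hu : u ∈ T) : orthoSeq H ℓ y u ⬝ᵥ p = if u = w then 1 else 0 :=
    congrFun hp ⟨u, hu⟩
  let g := Function.update (orthoSeq H ℓ y) v p
  have hgv : g v = p := Function.update_self ..
  have hg (u : V) (hu : u ≠ v) : g u = orthoSeq H ℓ y u := Function.update_of_ne hu ..
  have hsmul := orthoSeq_eq_smul (H := H) (ℓ := ℓ) (g := g) (k := ℓ v) (by
    intro u hu
    refine LinearIndepOn.of_eq_smul (hy _ (hℓ.isThin_lowerNeighbors (hu.trans hv.le)))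
      fun x hx => ⟨1, one_ne_zero, ?_⟩
    have := (mem_lowerNeighbors.1 hx).2
    rw [one_smul, hg]
    rintro rfl
    omega) (by
    intro u x hx hxu hlt
    rw [hg u (by rintro rfl; omega)]
    by_cases hxv : x = v
    · subst hxv
      rw [hgv, hp' u (Finset.mem_insert_of_mem (mem_lowerNeighbors.2 ⟨hxu, hlt⟩)), if_neg]
      rintro rfl
      exact hadj hxu
    · rw [hg x hxv]
      exact orthoSeq_dotProduct y hxu hlt)
  obtain ⟨a, ha, haw⟩ := hsmul w hle
  obtain ⟨b, hb, hbv⟩ := hsmul v le_rfl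
  refine ⟨g, ?_⟩
  rw [haw, hbv, hgv, hg w hne, smul_dotProduct, dotProduct_smul,
    hp' w (Finset.mem_insert_self ..), if_pos rfl]
  simp [ha, hb]

/-- Vectors in `ℝ^d`, where `d` exceeds all degrees of `H`, whose orthogonality graph is `H`. -/
lemma exists_dotProduct_eq_zero_iff_adj (H : SimpleGraph V) [DecidableRel H.Adj] {d : ℕ}
    (hd : ∀ v, H.degree v < d) :
    ∃ f : V → Fin d → ℝ, ∀ u v, u ≠ v → (f u ⬝ᵥ f v = 0 ↔ H.Adj u v) := by
  obtain ⟨ℓ, hℓ⟩ := exists_isGreedyLeveling H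
  have hlt (v : V) : ℓ v < d := by
    refine lt_of_le_of_lt ?_ (hd v)
    rw [← hℓ.card_eq v, ← H.card_neighborFinset_eq_degree]
    refine Finset.card_le_card fun u hu => ?_
    rw [H.mem_neighborFinset]
    exact (mem_lowerNeighbors.1 hu).1
  obtain ⟨y, hy⟩ := exists_forall_orthoSeq_dotProduct_ne_zero (H := H) (ℓ := ℓ) (d := d)
    (κ := {a : V × V // a.1 ≠ a.2 ∧ ¬ H.Adj a.1 a.2}) (fun a => a.1.1) (fun a => a.1.2) (by
      rintro ⟨⟨u, v⟩, hne, hadj⟩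
      rcases le_total (ℓ u) (ℓ v) with h | h
      · exact hℓ.exists_orthoSeq_dotProduct_ne_zero (hlt v) h hne fun h => hadj h.symm
      · obtain ⟨y, hy⟩ := hℓ.exists_orthoSeq_dotProduct_ne_zero (hlt u) h hne.symm hadj
        exact ⟨y, by rwa [dotProduct_comm]⟩)
  refine ⟨orthoSeq H ℓ y, fun u v hne => ⟨fun h => ?_, fun h => ?_⟩⟩
  · by_contra hadj
    exact hy ⟨(u, v), hne, hadj⟩ h
  · rcases lt_or_gt_of_ne (hℓ.ne_of_adj h) with hl | hl
    · exact orthoSeq_dotProduct y h.symm hl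
    · rw [dotProduct_comm]
      exact orthoSeq_dotProduct y h hl

end Leveling

/-- Every simple connected graph `G` with `|G| ≥ 4` has an orthogonal representation in
`ℝ^{|G| - δ(G)}`; consequently `msr(G) ≤ |G| - δ(G)`, i.e. `G` satisfies the Delta
Conjecture. -/
theorem delta_conjecture_of_card_ge_four {V : Type*} [Fintype V]
    (G : SimpleGraph V) [DecidableRel G.Adj]
    (hconn : G.Connected) (hcard : 4 ≤ Fintype.card V) :
    HasOrthoRep G (Fintype.card V - G.minDegree) ∧
    msr G ≤ Fintype.card V - G.minDegree := by
  classical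
  have : Nonempty V := hconn.nonempty
  have hrep : HasOrthoRep G (Fintype.card V - G.minDegree) := by
    obtain ⟨f, hf⟩ := exists_dotProduct_eq_zero_iff_adj Gᶜ
      (d := Fintype.card V - G.minDegree) fun v => by
        have h1 := G.minDegree_le_degree v
        have h2 := G.degree_lt_card_verts v
        rw [SimpleGraph.degree_compl]
        omega
    refine ⟨fun v => WithLp.toLp 2 (f v), fun i j hij => ?_⟩
    have h1 : ⟪WithLp.toLp 2 (f i), WithLp.toLp 2 (f j)⟫ = f i ⬝ᵥ f j := by
      simp [PiLp.inner_apply, dotProduct, mul_comm]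
    rw [h1, ne_eq, hf i j hij, SimpleGraph.compl_adj]
    tauto
  exact ⟨hrep, Nat.sInf_le hrep⟩
end

section
/- For all n ≥ 3 and m ≥ 4, the complement of the Cartesian product K_n □ P_m has an orthogonal representation in ℝ^{n+2}; consequently msr(complement of K_n □ P_m) ≤ Δ(K_n □ P_m) + 1 = n + 2. -/
open SimpleGraph
open scoped RealInnerProductSpace

noncomputable instance (n m : ℕ) :
    DecidableRel (((⊤ : SimpleGraph (Fin n)) □ pathGraph m).Adj) :=
  Classical.decRel _

/-- Over an infinite field, a subspace contained in none of finitely many subspaces has a vector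
lying outside all of them. -/
theorem Submodule.exists_mem_forall_notMem_of_finite {k E : Type*} [Field k] [Infinite k]
    [AddCommGroup E] [Module k E] (X : Submodule k E) {T : Set (Submodule k E)} (hT : T.Finite)
    (h : ∀ p ∈ T, ¬ X ≤ p) : ∃ x ∈ X, ∀ p ∈ T, x ∉ p := by
  by_contra! hc
  have : Finite T := hT
  obtain ⟨p, hp⟩ := Subspace.exists_eq_top_of_iUnion_eq_univ
    (p := fun p : T => (p : Submodule k E).comap X.subtype) <| by
      refine Set.eq_univ_of_forall fun x => ?_
      obtain ⟨p, hp, hx⟩ := hc x x.2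
      exact Set.mem_iUnion.2 ⟨⟨p, hp⟩, hx⟩
  exact h p p.2 (Submodule.comap_subtype_eq_top.1 hp)

theorem Submodule.mem_sup_span_singleton_exchange {k E : Type*} [Field k] [AddCommGroup E]
    [Module k E] {Y : Submodule k E} {x w : E} (hw : w ∉ Y) (h : w ∈ Y ⊔ k ∙ x) :
    x ∈ Y ⊔ k ∙ w := by
  obtain ⟨y, hy, z, hz, rfl⟩ := Submodule.mem_sup.1 h
  obtain ⟨c, rfl⟩ := Submodule.mem_span_singleton.1 hz
  have hc : c ≠ 0 := by
    rintro rfl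
    simp [hy] at hw
  refine Submodule.mem_sup.2 ⟨-(c⁻¹ • y), Y.neg_mem (Y.smul_mem _ hy), c⁻¹ • (y + c • x),
    Submodule.smul_mem _ _ (Submodule.mem_span_singleton_self _), ?_⟩
  simp [smul_smul, hc]

section

variable {E : Type*} [NormedAddCommGroup E] [InnerProductSpace ℝ E] [FiniteDimensional ℝ E]

theorem not_orthogonal_sup_le_sup_of_finrank {S : Submodule ℝ E} (a b w : E)
    (hS : Module.finrank ℝ S + 3 < Module.finrank ℝ E) :
    ¬ ((ℝ ∙ a) ⊔ S)ᗮ ≤ (ℝ ∙ b) ⊔ S ⊔ ℝ ∙ w := by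
  intro hle
  have one (z : E) : Module.finrank ℝ (ℝ ∙ z) ≤ 1 := by
    simpa using finrank_span_le_card (R := ℝ) ({z} : Set E)
  have hperp := Submodule.finrank_add_finrank_orthogonal ((ℝ ∙ a) ⊔ S)
  have hdisj : ((ℝ ∙ a) ⊔ S)ᗮ ⊓ S = ⊥ :=
    ((Submodule.orthogonal_disjoint ((ℝ ∙ a) ⊔ S)).symm.mono_right le_sup_right).eq_bot
  have hadd := Submodule.finrank_sup_add_finrank_inf_eq ((ℝ ∙ a) ⊔ S)ᗮ S
  rw [hdisj, finrank_bot] at hadd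
  have hmono : Module.finrank ℝ ↥(((ℝ ∙ a) ⊔ S)ᗮ ⊔ S) ≤
      Module.finrank ℝ ↥((ℝ ∙ b) ⊔ S ⊔ ℝ ∙ w) :=
    Submodule.finrank_mono (sup_le hle (le_sup_right.trans le_sup_left))
  have h₁ := Submodule.finrank_add_le_finrank_add_finrank (ℝ ∙ a) S
  have h₂ := Submodule.finrank_add_le_finrank_add_finrank (ℝ ∙ b) S
  have h₃ := Submodule.finrank_add_le_finrank_add_finrank ((ℝ ∙ b) ⊔ S) (ℝ ∙ w)
  have := one a
  have := one b
  have := one w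
  omega

/-- In dimension at least `n + 2` there are `n` pairwise orthogonal vectors, the `j`-th of which is
orthogonal to `u j` and to no vector of the finite set `W j`, as long as `W j` avoids the line
spanned by `u j`. -/
theorem exists_pairwise_orthogonal_avoiding {n : ℕ} (hE : n + 2 ≤ Module.finrank ℝ E)
    (u : Fin n → E) (W : Fin n → Set E) (hfin : ∀ j, (W j).Finite)
    (hW : ∀ j, ∀ w ∈ W j, w ∉ ℝ ∙ u j) :
    ∃ v : Fin n → E, (∀ i j, i ≠ j → ⟪v i, v j⟫ = 0) ∧ (∀ j, ⟪u j, v j⟫ = 0) ∧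
      ∀ j, ∀ w ∈ W j, ⟪w, v j⟫ ≠ 0 := by
  have key : ∀ k ≤ n, ∃ v : Fin n → E, ∃ S : Submodule ℝ E, Module.finrank ℝ S ≤ k ∧
      (∀ i : Fin n, i < k → v i ∈ S) ∧
      (∀ i j : Fin n, i < k → j < k → i ≠ j → ⟪v i, v j⟫ = 0) ∧
      (∀ j : Fin n, j < k → ⟪u j, v j⟫ = 0) ∧
      (∀ j : Fin n, j < k → ∀ w ∈ W j, ⟪w, v j⟫ ≠ 0) ∧
      ∀ j : Fin n, k ≤ j → ∀ w ∈ W j, w ∉ (ℝ ∙ u j) ⊔ S := by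
    intro k
    induction k with
    | zero => exact fun _ => ⟨0, ⊥, by simpa using hW⟩
    | succ k ih =>
      intro hk
      obtain ⟨v, S, hS, hvS, hvv, huv, hWv, hWS⟩ := ih (by omega)
      let p : Fin n := ⟨k, hk⟩
      obtain ⟨x, hxX, hx⟩ := Submodule.exists_mem_forall_notMem_of_finite ((ℝ ∙ u p) ⊔ S)ᗮ
        (T := (fun w => (ℝ ∙ w)ᗮ) '' W p ∪
          ⋃ j ∈ {j : Fin n | p < j}, (fun w => (ℝ ∙ u j) ⊔ S ⊔ ℝ ∙ w) '' W j)
        (((hfin p).image _).union ((Set.toFinite _).biUnion fun j _ => (hfin j).image _)) <| by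
          rintro _ (⟨w, hw, rfl⟩ | h)
          · rw [Submodule.orthogonal_le_orthogonal_iff, Submodule.span_singleton_le_iff_mem]
            exact hWS p le_rfl w hw
          · simp only [Set.mem_iUnion] at h
            obtain ⟨j, hj, w, hw, rfl⟩ := h
            have hkj : k < j := hj
            exact not_orthogonal_sup_le_sup_of_finrank _ _ _ (by omega)
      have hxu : ⟪u p, x⟫ = 0 := Submodule.inner_right_of_mem_orthogonal
        (Submodule.mem_sup_left (Submodule.mem_span_singleton_self _)) hxX
      have hxS : ∀ y ∈ S, ⟪y, x⟫ = 0 := fun y hy =>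
        Submodule.inner_right_of_mem_orthogonal (Submodule.mem_sup_right hy) hxX
      have hlt : ∀ {i : Fin n}, i < k + 1 → i ≠ p → i < k := by
        intro i hi hip
        have : (i : ℕ) ≠ k := fun h => hip (Fin.ext h)
        omega
      refine ⟨Function.update v p x, S ⊔ ℝ ∙ x, ?_, ?_, ?_, ?_, ?_, ?_⟩
      · have h₁ := Submodule.finrank_add_le_finrank_add_finrank S (ℝ ∙ x)
        have h₂ : Module.finrank ℝ (ℝ ∙ x) ≤ 1 := by
          simpa using finrank_span_le_card (R := ℝ) ({x} : Set E)
        omega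
      · intro i hi
        obtain rfl | hip := eq_or_ne i p
        · simpa using Submodule.mem_sup_right (Submodule.mem_span_singleton_self x)
        · simpa [hip] using Submodule.mem_sup_left (hvS i (hlt hi hip))
      · intro i j hi hj hij
        obtain rfl | hip := eq_or_ne i p
        · simpa [hij.symm, real_inner_comm] using hxS _ (hvS j (hlt hj hij.symm))
        · obtain rfl | hjp := eq_or_ne j p
          · simpa [hip] using hxS _ (hvS i (hlt hi hip))
          · simpa [hip, hjp] using hvv i j (hlt hi hip) (hlt hj hjp) hij
      · intro j hj
        obtain rfl | hjp := eq_or_ne j p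
        · simpa using hxu
        · simpa [hjp] using huv j (hlt hj hjp)
      · intro j hj w hw
        obtain rfl | hjp := eq_or_ne j p
        · have := hx _ (Or.inl ⟨w, hw, rfl⟩)
          rw [Submodule.mem_orthogonal_singleton_iff_inner_right] at this
          simpa using this
        · simpa [hjp] using hWv j (hlt hj hjp) w hw
      · intro j hj w hw hmem
        rw [← sup_assoc] at hmem
        refine hx ((ℝ ∙ u j) ⊔ S ⊔ ℝ ∙ w) (Or.inr ?_)
          (Submodule.mem_sup_span_singleton_exchange (hWS j (by omega) w hw) hmem)
        simp only [Set.mem_iUnion]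
        exact ⟨j, show k < (j : ℕ) by omega, w, hw, rfl⟩
  obtain ⟨v, -, -, -, hvv, huv, hWv, -⟩ := key n le_rfl
  exact ⟨v, fun i j => hvv i j i.2 j.2, fun j => huv j j.2, fun j => hWv j j.2⟩

/-- For `n ≥ 3`, in dimension at least `n + 2` there are arbitrarily long sequences of orthogonal
`n`-tuples such that vectors of different tuples are orthogonal exactly when they have the same
index and the tuples are consecutive. -/
theorem exists_layered_orthogonal {n : ℕ} (hn : 3 ≤ n) (hE : n + 2 ≤ Module.finrank ℝ E) (L : ℕ) :
    ∃ f : ℕ → Fin n → E, (∀ a ≤ L, ∀ i, f a i ≠ 0) ∧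
      (∀ a ≤ L, ∀ i j, i ≠ j → ⟪f a i, f a j⟫ = 0) ∧
      ∀ a b, a < b → b ≤ L → ∀ i j, ⟪f a i, f b j⟫ = 0 ↔ b = a + 1 ∧ i = j := by
  have : Nontrivial (Fin n) := Fin.nontrivial_iff_two_le.2 (by omega)
  induction L with
  | zero =>
    have : Nontrivial E := Module.nontrivial_of_finrank_pos (R := ℝ) (by omega)
    obtain ⟨e, he⟩ := exists_ne (0 : E)
    obtain ⟨v, hvv, -, hv⟩ := exists_pairwise_orthogonal_avoiding hE (fun _ => 0) (fun _ => {e})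
      (fun _ => Set.finite_singleton e) (fun _ => by simpa using he)
    refine ⟨fun _ => v, fun _ _ i h => hv i e rfl (by simp [h]), fun _ _ => hvv, ?_⟩
    intro a b hab hb
    omega
  | succ L ih =>
    obtain ⟨f, hf0, hff, hfg⟩ := ih
    have hline : ∀ a ≤ L, ∀ i j, (a = L → i ≠ j) → f a i ∉ ℝ ∙ f L j := by
      intro a ha i j hij hmem
      obtain ⟨c, hc⟩ := Submodule.mem_span_singleton.1 hmem
      obtain rfl | hlt := ha.eq_or_lt
      · refine hf0 a le_rfl i (inner_self_eq_zero (𝕜 := ℝ).1 ?_)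
        nth_rw 1 [← hc]
        rw [inner_smul_left, hff a le_rfl j i (hij rfl).symm, mul_zero]
      · obtain ⟨k, hk⟩ : ∃ k : Fin n, k ∉ ({i, j} : Finset (Fin n)) := by
          by_contra! h
          have h₁ : (Finset.univ : Finset (Fin n)) ⊆ {i, j} := fun k _ => h k
          have h₂ := (Finset.card_le_card h₁).trans Finset.card_le_two
          simp at h₂
          omega
        simp only [Finset.mem_insert, Finset.mem_singleton, not_or] at hk
        refine hk.1 ((hfg a L hlt le_rfl i k).1 ?_).2.symm
        rw [← hc, inner_smul_left, hff L le_rfl j k (Ne.symm hk.2), mul_zero]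
    obtain ⟨v, hvv, huv, hv⟩ := exists_pairwise_orthogonal_avoiding hE (f L)
      (fun j => (fun q : ℕ × Fin n => f q.1 q.2) ''
        {q | q.1 ≤ L ∧ (q.1 = L → q.2 ≠ j)})
      (fun j => (((Set.finite_Iic L).prod Set.finite_univ).subset
        fun q hq => ⟨hq.1, trivial⟩).image _)
      (by
        rintro j _ ⟨q, hq, rfl⟩
        exact hline _ hq.1 _ _ hq.2)
    replace hv : ∀ a ≤ L, ∀ i j, (a = L → i ≠ j) → ⟪f a i, v j⟫ ≠ 0 :=
      fun a ha i j h => hv j _ ⟨(a, i), ⟨ha, h⟩, rfl⟩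
    refine ⟨Function.update f (L + 1) v, ?_, ?_, ?_⟩
    · intro a ha i
      obtain rfl | hlt := ha.eq_or_lt
      · obtain ⟨j, hj⟩ := exists_ne i
        intro h
        exact hv L le_rfl j i (fun _ => hj) (by simp_all)
      · simpa [hlt.ne] using hf0 a (by omega) i
    · intro a ha
      obtain rfl | hlt := ha.eq_or_lt
      · simpa using hvv
      · simpa [hlt.ne] using hff a (by omega)
    · intro a b hab hb i j
      have haL : a ≠ L + 1 := by omega
      obtain rfl | hlt := hb.eq_or_lt
      · simp only [Function.update_of_ne haL, Function.update_self]
        constructor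
        · intro h
          by_contra hne
          exact hv a (by omega) i j (fun haL' hij => hne ⟨by omega, hij⟩) h
        · rintro ⟨h, rfl⟩
          obtain rfl : a = L := by omega
          exact huv i
      · simpa [haL, hlt.ne] using hfg a b hab (by omega) i j

end

theorem hasOrthoRep_compl_boxProd_pathGraph {n : ℕ} (hn : 3 ≤ n) (m : ℕ) :
    HasOrthoRep (((⊤ : SimpleGraph (Fin n)) □ pathGraph m)ᶜ) (n + 2) := by
  obtain ⟨f, -, hff, hfg⟩ := exists_layered_orthogonal (E := EuclideanSpace ℝ (Fin (n + 2))) hn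
    (by simp) m
  refine ⟨fun x => f x.2 x.1, ?_⟩
  rintro ⟨i, a⟩ ⟨j, b⟩ hne
  have hne' : ¬ (i = j ∧ a = b) := by simpa using hne
  rw [compl_adj, and_iff_right hne, boxProd_adj, top_adj, pathGraph_adj]
  refine not_congr ?_
  simp only [Fin.ext_iff (a := a)] at hne' ⊢
  rcases lt_trichotomy (a : ℕ) b with hab | hab | hab
  · rw [hfg a b hab b.2.le i j]
    grind
  · have hij : i ≠ j := fun h => hne' ⟨h, hab⟩
    rw [hab]
    exact iff_of_true (hff b b.2.le i j hij) (Or.inl ⟨hij, rfl⟩)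
  · rw [real_inner_comm, hfg b a hab a.2.le j i]
    grind

theorem degree_pathGraph_le {m : ℕ} (a : Fin m) [Fintype ((pathGraph m).neighborSet a)] :
    (pathGraph m).degree a ≤ 2 := by
  rw [← card_neighborFinset_eq_degree,
    ← Finset.card_map (Fin.valEmbedding : Fin m ↪ ℕ)]
  refine (Finset.card_le_card (t := {(a : ℕ) - 1, (a : ℕ) + 1}) ?_).trans Finset.card_le_two
  intro b hb
  simp only [Finset.mem_map, mem_neighborFinset, pathGraph_adj, Fin.valEmbedding_apply] at hb
  simp only [Finset.mem_insert, Finset.mem_singleton]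
  omega

theorem two_le_degree_pathGraph {m : ℕ} {a : Fin m} (h₀ : 1 ≤ (a : ℕ)) (h₁ : (a : ℕ) + 1 < m)
    [Fintype ((pathGraph m).neighborSet a)] : 2 ≤ (pathGraph m).degree a := by
  rw [← card_neighborFinset_eq_degree]
  refine le_trans (Finset.card_pair ?_).ge (Finset.card_le_card
    (s := {(⟨a - 1, by omega⟩ : Fin m), ⟨a + 1, h₁⟩}) ?_)
  · rw [ne_eq, Fin.mk.injEq]
    omega
  · intro b hb
    simp only [Finset.mem_insert, Finset.mem_singleton] at hb
    rw [mem_neighborFinset, pathGraph_adj]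
    rcases hb with rfl | rfl
    · exact Or.inr (Nat.sub_add_cancel h₀)
    · exact Or.inl rfl

theorem maxDegree_boxProd_pathGraph {n m : ℕ} (hn : 1 ≤ n) (hm : 3 ≤ m)
    [DecidableRel ((⊤ : SimpleGraph (Fin n)) □ pathGraph m).Adj] :
    ((⊤ : SimpleGraph (Fin n)) □ pathGraph m).maxDegree = n + 1 := by
  classical
  apply le_antisymm
  · refine maxDegree_le_of_forall_degree_le _ _ fun x => ?_
    rw [degree_boxProd, complete_graph_degree, Fintype.card_fin]
    have := degree_pathGraph_le x.2
    omega
  · refine le_trans ?_ (degree_le_maxDegree _ (⟨0, hn⟩, ⟨1, by omega⟩))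
    rw [degree_boxProd, complete_graph_degree, Fintype.card_fin]
    have := two_le_degree_pathGraph (m := m) (a := ⟨1, by omega⟩) le_rfl hm
    dsimp only
    omega

/-- For all `n ≥ 3` and `m ≥ 4`, the complement of `Kₙ □ Pₘ` has an orthogonal
representation in `ℝ^{n+2}`; consequently
`msr((Kₙ □ Pₘ)ᶜ) ≤ Δ(Kₙ □ Pₘ) + 1 = n + 2`. -/
theorem compl_Kn_boxProd_Pm_orthoRep (n m : ℕ) (hn : 3 ≤ n) (hm : 4 ≤ m) :
    HasOrthoRep (((⊤ : SimpleGraph (Fin n)) □ pathGraph m)ᶜ) (n + 2) ∧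
    msr (((⊤ : SimpleGraph (Fin n)) □ pathGraph m)ᶜ) ≤ n + 2 ∧
    ((⊤ : SimpleGraph (Fin n)) □ pathGraph m).maxDegree + 1 = n + 2 := by
  have h := hasOrthoRep_compl_boxProd_pathGraph hn m
  exact ⟨h, Nat.sInf_le h, by rw [maxDegree_boxProd_pathGraph (by omega) (by omega)]⟩
end
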